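/- Let S_1,…,S_K ⊆ ℂ be pairwise distinct finite nonempty constellation sets, let N₀ > 0, fix i ∈ {1,…,K}, and let (r_n)_{n∈ℕ} be an i.i.d. family of ℂ-valued random variables with law P_{S_i,N₀}. Let (A_t)_{t≥1} be any sequence of finite subsets of ℕ with |A_t| → ∞. Then lim_{t→∞} ℙ( there exists j ≠ i with Σ_{n∈A_t} log f_{S_j,N₀}(r_n) ≥ Σ_{n∈A_t} log f_{S_i,N₀}(r_n) ) = 0. (Theorem 3: with L sensors observing pairwise disjoint index sets 𝓘_1,…,𝓘_L of the symbol stream, taking A = 𝓘_1 ∪ … ∪ 𝓘_L, the fused ML classifier achieves vanishing error probability as the total number of observations Σ_l |𝓘_l| → ∞, regardless of the received SNRs at the sensors.) -/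

import Mathlib

open Real MeasureTheory ProbabilityTheory Filter

/-- The equal-weight homoscedastic complex Gaussian mixture density
`f_{S,N₀}(r) = (1/|S|) · Σ_{μ ∈ S} (1/(π N₀)) · exp(−|r − μ|²/N₀)`. -/
noncomputable def mixDensity (S : Finset ℂ) (N₀ : ℝ) (r : ℂ) : ℝ :=
  (S.card : ℝ)⁻¹ * ∑ μ ∈ S, (π * N₀)⁻¹ * Real.exp (-(‖r - μ‖) ^ 2 / N₀)

/-- The probability measure `P_{S,N₀}` on `ℂ` with density `f_{S,N₀}` w.r.t. Lebesgue measure. -/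
noncomputable def mixMeasure (S : Finset ℂ) (N₀ : ℝ) : Measure ℂ :=
  volume.withDensity fun r => ENNReal.ofReal (mixDensity S N₀ r)

/-- Kullback–Leibler divergence `∫ log (dP/dQ) dP` of measures (`⊤` if `P` is not absolutely
continuous w.r.t. `Q` or the log-likelihood ratio is not integrable). -/
noncomputable def klDiv {α : Type*} [MeasurableSpace α] (P Q : Measure α) : EReal := by
  classical
  exact if P ≪ Q ∧ Integrable (llr P Q) P then ((∫ x, llr P Q x ∂P : ℝ) : EReal) else ⊤


lemma mix_continuous (S : Finset ℂ) (N₀ : ℝ) : Continuous (mixDensity S N₀) := by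
  unfold mixDensity
  fun_prop

lemma mix_pos (S : Finset ℂ) (hS : S.Nonempty) (N₀ : ℝ) (hN : 0 < N₀) (x : ℂ) :
    0 < mixDensity S N₀ x := by
  unfold mixDensity
  have h : 0 < S.card := hS.card_pos
  apply mul_pos (by positivity)
  exact Finset.sum_pos (fun μ _ => by positivity) hS

lemma gauss_integral (N₀ : ℝ) (hN : 0 < N₀) (μ : ℂ) :
    ∫ r : ℂ, Real.exp (-(‖r - μ‖) ^ 2 / N₀) = π * N₀ := by
  rw [integral_sub_right_eq_self (fun r : ℂ => Real.exp (-(‖r‖) ^ 2 / N₀)) μ]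
  have h := GaussianFourier.integral_rexp_neg_mul_sq_norm (V := ℂ) (b := N₀⁻¹) (by positivity)
  simp only [Complex.finrank_real_complex] at h
  norm_num at h
  rw [← h]
  congr 1
  ext v
  congr 1
  ring

lemma gauss_integrable (N₀ : ℝ) (hN : 0 < N₀) (μ : ℂ) :
    Integrable (fun r : ℂ => Real.exp (-(‖r - μ‖) ^ 2 / N₀)) := by
  by_contra h
  have := integral_undef h
  rw [gauss_integral N₀ hN] at this
  have : 0 < π * N₀ := by positivity
  linarith

lemma mix_integrable (S : Finset ℂ) (N₀ : ℝ) (hN : 0 < N₀) :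
    Integrable (mixDensity S N₀) := by
  unfold mixDensity
  exact (integrable_finsetSum _ fun μ _ => (gauss_integrable N₀ hN μ).const_mul _).const_mul _

lemma mix_integral (S : Finset ℂ) (hS : S.Nonempty) (N₀ : ℝ) (hN : 0 < N₀) :
    ∫ r, mixDensity S N₀ r = 1 := by
  unfold mixDensity
  rw [integral_const_mul, integral_finsetSum _ fun μ _ => (gauss_integrable N₀ hN μ).const_mul _]
  simp_rw [integral_const_mul, gauss_integral N₀ hN]
  have h : (S.card : ℝ) ≠ 0 := by exact_mod_cast hS.card_pos.ne'
  have : π * N₀ ≠ 0 := by positivity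
  simp only [inv_mul_cancel₀ this, Finset.sum_const, nsmul_eq_mul, mul_one]
  exact inv_mul_cancel₀ h

/-- the character `r ↦ exp (2 Re(r conj μ) / N₀)` -/
noncomputable def expChar (N₀ : ℝ) (μ : ℂ) : Multiplicative ℂ →* ℝ where
  toFun r := Real.exp (2 * (r.toAdd.re * μ.re + r.toAdd.im * μ.im) / N₀)
  map_one' := by simp
  map_mul' x y := by
    rw [← Real.exp_add]
    simp only [toAdd_mul, Complex.add_re, Complex.add_im]
    congr 1
    ring

lemma expChar_inj (N₀ : ℝ) (hN : 0 < N₀) : Function.Injective (expChar N₀) := by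
  intro μ ν h
  have h1 := DFunLike.congr_fun h (Multiplicative.ofAdd (1 : ℂ))
  have h2 := DFunLike.congr_fun h (Multiplicative.ofAdd Complex.I)
  simp [expChar, hN.ne'] at h1 h2
  exact Complex.ext h1 h2

lemma mix_inj (S T : Finset ℂ) (hS : S.Nonempty) (hT : T.Nonempty) (N₀ : ℝ) (hN : 0 < N₀)
    (h : mixDensity S N₀ = mixDensity T N₀) : S = T := by
  classical
  have hli : LinearIndependent ℝ (fun μ : ℂ => (expChar N₀ μ : Multiplicative ℂ → ℝ)) :=
    (linearIndependent_monoidHom (Multiplicative ℂ) ℝ).comp _ (expChar_inj N₀ hN)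
  let c : Finset ℂ → ℂ → ℝ := fun S μ =>
    if μ ∈ S then (S.card : ℝ)⁻¹ * Real.exp (-‖μ‖ ^ 2 / N₀) else 0
  have key : ∀ (S U : Finset ℂ), S ⊆ U → ∀ r : ℂ,
      ∑ μ ∈ U, c S μ * expChar N₀ μ (Multiplicative.ofAdd r) =
        (π * N₀) * Real.exp (‖r‖ ^ 2 / N₀) * mixDensity S N₀ r := by
    intro S U hSU r
    rw [← Finset.sum_subset hSU (fun μ _ hμ => by simp [c, hμ])]
    unfold mixDensity
    rw [Finset.mul_sum, Finset.mul_sum]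
    refine Finset.sum_congr rfl fun μ hμ => ?_
    simp only [c, hμ, if_true, expChar, MonoidHom.coe_mk, OneHom.coe_mk, toAdd_ofAdd]
    have hp : π * N₀ ≠ 0 := by positivity
    have : Real.exp (-‖r - μ‖ ^ 2 / N₀) = Real.exp (-‖r‖ ^ 2 / N₀) *
        (Real.exp (-‖μ‖ ^ 2 / N₀) * Real.exp (2 * (r.re * μ.re + r.im * μ.im) / N₀)) := by
      rw [← Real.exp_add, ← Real.exp_add]
      congr 1
      simp only [Complex.sq_norm, Complex.normSq_apply, Complex.sub_re, Complex.sub_im]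
      ring
    rw [this]
    have e : Real.exp (‖r‖ ^ 2 / N₀) * Real.exp (-‖r‖ ^ 2 / N₀) = 1 := by
      rw [← Real.exp_add, ← Real.exp_zero]; congr 1; ring
    calc _ = (Real.exp (‖r‖ ^ 2 / N₀) * Real.exp (-‖r‖ ^ 2 / N₀)) * ((π * N₀) * (π * N₀)⁻¹) *
          ((S.card : ℝ)⁻¹ * Real.exp (-‖μ‖ ^ 2 / N₀) *
            Real.exp (2 * (r.re * μ.re + r.im * μ.im) / N₀)) := by
            rw [e, mul_inv_cancel₀ hp]; ring
      _ = _ := by ring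
  have hz := linearIndependent_iff'.1 hli (S ∪ T) (fun μ => c S μ - c T μ) (by
    ext r
    simp only [Finset.sum_apply, Pi.smul_apply, smul_eq_mul, sub_mul, Finset.sum_sub_distrib,
      Pi.zero_apply]
    have a := key S (S ∪ T) Finset.subset_union_left r.toAdd
    have b := key T (S ∪ T) Finset.subset_union_right r.toAdd
    rw [← h] at b
    simp only [ofAdd_toAdd] at a b
    rw [a, b, sub_self])
  have hs : (S.card : ℝ) ≠ 0 := by exact_mod_cast hS.card_pos.ne'
  have ht : (T.card : ℝ) ≠ 0 := by exact_mod_cast hT.card_pos.ne'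
  ext μ
  constructor
  · intro hm
    by_contra hn
    have := hz μ (Finset.mem_union_left _ hm)
    simp [c, hm, hn] at this
    simp [this] at hS
  · intro hm
    by_contra hn
    have := hz μ (Finset.mem_union_right _ hm)
    simp [c, hm, hn] at this
    simp [this] at hT

lemma bc_lt_one (S T : Finset ℂ) (hS : S.Nonempty) (hT : T.Nonempty) (N₀ : ℝ) (hN : 0 < N₀)
    (hne : S ≠ T) :
    ∫⁻ x, ENNReal.ofReal (√(mixDensity S N₀ x * mixDensity T N₀ x)) < 1 := by
  set f := mixDensity S N₀ with hf
  set g := mixDensity T N₀ with hg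
  have fc : Continuous f := mix_continuous _ _
  have gc : Continuous g := mix_continuous _ _
  have fp : ∀ x, 0 < f x := mix_pos S hS N₀ hN
  have gp : ∀ x, 0 < g x := mix_pos T hT N₀ hN
  have fi : Integrable f := mix_integrable S N₀ hN
  have gi : Integrable g := mix_integrable T N₀ hN
  let d : ℂ → ℝ := fun x => (√(f x) - √(g x)) ^ 2
  have dc : Continuous d := by fun_prop
  have dn : ∀ x, 0 ≤ d x := fun x => sq_nonneg _
  have eq : ∀ x, √(f x * g x) = (f x + g x) / 2 - d x / 2 := by
    intro x
    rw [Real.sqrt_mul (fp x).le]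
    have := Real.sq_sqrt (fp x).le
    have := Real.sq_sqrt (gp x).le
    simp only [d]
    nlinarith
  have di : Integrable d := by
    refine (fi.add gi).mono' dc.aestronglyMeasurable (ae_of_all _ fun x => ?_)
    rw [Real.norm_of_nonneg (dn x)]
    have := eq x
    have := Real.sqrt_nonneg (f x * g x)
    simp only [Pi.add_apply]
    linarith
  have dpos : 0 < ∫ x, d x := by
    rw [integral_pos_iff_support_of_nonneg dn di]
    refine IsOpen.measure_pos volume dc.isOpen_support ?_
    by_contra h
    apply hne
    apply mix_inj S T hS hT N₀ hN
    ext x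
    have hx : d x = 0 := by
      by_contra hx
      exact h ⟨x, hx⟩
    have h1 : √(f x) = √(g x) := by
      have := pow_eq_zero_iff (two_ne_zero) |>.1 hx
      linarith
    exact (Real.sqrt_inj (fp x).le (gp x).le).1 h1
  have si : Integrable (fun x => √(f x * g x)) := by
    simp_rw [eq]
    exact ((fi.add gi).div_const 2).sub (di.div_const 2)
  rw [← ofReal_integral_eq_lintegral_ofReal si (ae_of_all _ fun x => Real.sqrt_nonneg _)]
  rw [ENNReal.ofReal_lt_one]
  simp_rw [eq]
  have hsum : Integrable (fun x => (f x + g x) / 2) := (fi.add gi).div_const 2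
  rw [integral_sub hsum (di.div_const 2), integral_div, integral_div,
    integral_add fi gi, mix_integral S hS N₀ hN, mix_integral T hT N₀ hN]
  linarith

lemma pair_bound {Ω : Type*} [MeasurableSpace Ω] (P : Measure Ω)
    (S T : Finset ℂ) (hS : S.Nonempty) (hT : T.Nonempty) (N₀ : ℝ) (hN : 0 < N₀)
    (r : ℕ → Ω → ℂ) (hmeas : ∀ n, Measurable (r n))
    (hindep : iIndepFun r P)
    (hlaw : ∀ n, Measure.map (r n) P = mixMeasure S N₀) (A : Finset ℕ) :
    P {ω | ∑ n ∈ A, Real.log (mixDensity S N₀ (r n ω)) ≤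
          ∑ n ∈ A, Real.log (mixDensity T N₀ (r n ω))} ≤
      (∫⁻ x, ENNReal.ofReal (√(mixDensity S N₀ x * mixDensity T N₀ x))) ^ A.card := by
  have fc : Continuous (mixDensity S N₀) := mix_continuous _ _
  have gc : Continuous (mixDensity T N₀) := mix_continuous _ _
  have fp : ∀ x, 0 < mixDensity S N₀ x := mix_pos S hS N₀ hN
  have gp : ∀ x, 0 < mixDensity T N₀ x := mix_pos T hT N₀ hN
  set G : ℂ → ENNReal := fun x => ENNReal.ofReal (√(mixDensity T N₀ x / mixDensity S N₀ x)) with hG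
  have Gm : Measurable G :=
    ENNReal.measurable_ofReal.comp (gc.measurable.div fc.measurable).sqrt
  have hint : ∀ n, ∫⁻ ω, G (r n ω) ∂P =
      ∫⁻ x, ENNReal.ofReal (√(mixDensity S N₀ x * mixDensity T N₀ x)) := by
    intro n
    rw [← lintegral_map Gm (hmeas n), hlaw, mixMeasure,
      lintegral_withDensity_eq_lintegral_mul _ fc.measurable.ennreal_ofReal Gm]
    refine lintegral_congr fun x => ?_
    simp only [Pi.mul_apply, hG]
    rw [← ENNReal.ofReal_mul (fp x).le]
    congr 1
    rw [Real.sqrt_div (gp x).le, Real.sqrt_mul (fp x).le]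
    have h1 := Real.sq_sqrt (fp x).le
    have h2 := Real.sqrt_pos.2 (fp x)
    field_simp
    rw [h1]
    ring
  have hprod := lintegral_prod_eq_prod_lintegral_of_indepFun A (fun n ω => G (r n ω))
    (hindep.comp (fun _ => G) (fun _ => Gm)) (fun n => Gm.comp (hmeas n))
  simp only [hint, Finset.prod_const] at hprod
  rw [← hprod]
  have hm := mul_meas_ge_le_lintegral (μ := P)
    (Finset.measurable_fun_prod A fun n _ => Gm.comp (hmeas n)) 1
  rw [one_mul] at hm
  refine (measure_mono ?_).trans hm
  intro ω hω
  simp only [Set.mem_ofPred_eq, Function.comp_apply, hG] at hω ⊢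
  rw [← ENNReal.ofReal_prod_of_nonneg (fun n _ => Real.sqrt_nonneg _), ENNReal.one_le_ofReal]
  have hpp : ∀ n, 0 < √(mixDensity T N₀ (r n ω) / mixDensity S N₀ (r n ω)) :=
    fun n => Real.sqrt_pos.2 (div_pos (gp _) (fp _))
  rw [← Real.log_nonneg_iff (Finset.prod_pos fun n _ => hpp n),
    Real.log_prod (fun n _ => (hpp n).ne')]
  have : ∀ n, Real.log (√(mixDensity T N₀ (r n ω) / mixDensity S N₀ (r n ω))) =
      (Real.log (mixDensity T N₀ (r n ω)) - Real.log (mixDensity S N₀ (r n ω))) / 2 := by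
    intro n
    rw [Real.log_sqrt (div_pos (gp _) (fp _)).le, Real.log_div (gp _).ne' (fp _).ne']
  simp_rw [this]
  rw [← Finset.sum_div, Finset.sum_sub_distrib]
  linarith

/-- **Theorem 3.** Pooling observations over any index sets of growing size, the
fused ML classifier achieves vanishing error probability. -/
theorem fused_ml_classifier_error_tendsto_zero {Ω : Type*} [MeasureSpace Ω]
    [IsProbabilityMeasure (ℙ : Measure Ω)]
    (K : ℕ) (S : Fin K → Finset ℂ) (hne : ∀ k, (S k).Nonempty)
    (hdist : Function.Injective S)
    (N₀ : ℝ) (hN₀ : 0 < N₀) (i : Fin K)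
    (r : ℕ → Ω → ℂ) (hmeas : ∀ n, Measurable (r n))
    (hindep : iIndepFun r ℙ)
    (hlaw : ∀ n, Measure.map (r n) ℙ = mixMeasure (S i) N₀)
    (A : ℕ → Finset ℕ) (hA : Tendsto (fun t => (A t).card) atTop atTop) :
    Tendsto
      (fun t : ℕ => (ℙ : Measure Ω) {ω | ∃ j ≠ i,
        ∑ n ∈ A t, Real.log (mixDensity (S i) N₀ (r n ω)) ≤
          ∑ n ∈ A t, Real.log (mixDensity (S j) N₀ (r n ω))})
      atTop (nhds 0) := by
  classical
  set ρ : Fin K → ENNReal := fun j =>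
    ∫⁻ x, ENNReal.ofReal (√(mixDensity (S i) N₀ x * mixDensity (S j) N₀ x)) with hρ
  have hlim : Tendsto (fun t => ∑ j ∈ Finset.univ.filter (· ≠ i), ρ j ^ (A t).card) atTop
      (nhds 0) := by
    have : Tendsto (fun t => ∑ j ∈ Finset.univ.filter (· ≠ i), ρ j ^ (A t).card) atTop
        (nhds (∑ j ∈ Finset.univ.filter (· ≠ i), (0 : ENNReal))) := by
      refine tendsto_finsetSum _ fun j hj => ?_
      have hji : j ≠ i := by simpa using hj
      have hlt : ρ j < 1 := bc_lt_one (S i) (S j) (hne i) (hne j) N₀ hN₀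
        (fun h => hji (hdist h).symm)
      exact (ENNReal.tendsto_pow_atTop_nhds_zero_of_lt_one hlt).comp hA
    simpa using this
  refine tendsto_of_tendsto_of_tendsto_of_le_of_le tendsto_const_nhds hlim
    (fun _ => zero_le) fun t => ?_
  refine (measure_mono ?_).trans ((measure_biUnion_finset_le
    (Finset.univ.filter (· ≠ i)) (fun j => {ω | ∑ n ∈ A t, Real.log (mixDensity (S i) N₀ (r n ω)) ≤
          ∑ n ∈ A t, Real.log (mixDensity (S j) N₀ (r n ω))})).trans
    (Finset.sum_le_sum fun j _ => pair_bound ℙ (S i) (S j) (hne i) (hne j) N₀ hN₀ r hmeas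
      hindep hlaw (A t)))
  rintro ω ⟨j, hj, h⟩
  simp only [Set.mem_iUnion, Set.mem_ofPred_eq]
  exact ⟨j, by simpa using hj, h⟩
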